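/- Let M and N be non-trivial 0-left cancellative monoids with zero, each admitting least common multiples. Then the 0-free product M ∗₀ N is a 0-left cancellative monoid with zero admitting least common multiples. -/

import Mathlib

open Monoid

/-- `s` divides `t` when `t ∈ {s} ∪ sM`. -/
def Divides {M : Type*} [Mul M] (s t : M) : Prop := t = s ∨ ∃ u, s * u = t

/-- `r` is a least common multiple of `s` and `t` when `sM ∩ tM = rM` and both `s` and `t`
divide `r`. -/
def IsLCM {M : Type*} [Mul M] (s t r : M) : Prop :=
  ({x | ∃ u, x = s * u} ∩ {x | ∃ u, x = t * u} = {x | ∃ u, x = r * u}) ∧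
    Divides s r ∧ Divides t r

/-- Membership in the two-sided ideal of the free product `M ∗ N` generated by the zero
elements of `M` and `N`. -/
def InZeroIdeal (M N : Type*) [Monoid M] [Monoid N] [Zero M] [Zero N]
    (x : Coprod M N) : Prop :=
  ∃ a b : Coprod M N,
    x = a * Coprod.inl (0 : M) * b ∨ x = a * Coprod.inr (0 : N) * b

/-- The Rees congruence on `M ∗ N` identifying the ideal generated by the zeros of `M`
and `N` to a single element. -/
def reesCon (M N : Type*) [Monoid M] [Monoid N] [Zero M] [Zero N] :
    Con (Coprod M N) :=
  conGen (fun x y => InZeroIdeal M N x ∧ InZeroIdeal M N y)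

/-- The `0`-free product `M ∗₀ N` of two monoids with zero: the Rees quotient of the
free product of monoids `M ∗ N` by the ideal generated by the zero elements. -/
def ZeroFreeProd (M N : Type*) [Monoid M] [Monoid N] [Zero M] [Zero N] :=
  (reesCon M N).Quotient

instance ZeroFreeProd.instMonoid (M N : Type*) [Monoid M] [Monoid N] [Zero M] [Zero N] :
    Monoid (ZeroFreeProd M N) :=
  inferInstanceAs (Monoid (reesCon M N).Quotient)

/-- The zero element of `M ∗₀ N`, namely the class of the ideal generated by the zeros. -/
def ZeroFreeProd.zero (M N : Type*) [Monoid M] [Monoid N] [Zero M] [Zero N] :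
    ZeroFreeProd M N :=
  (reesCon M N).mk' (Coprod.inl (0 : M))

section Abstract

variable {M N P : Type*} [MonoidWithZero M] [MonoidWithZero N] [MonoidWithZero P]

/-- Every nonzero element of `P` factors uniquely as `f m * q` with `m ≠ 0` and `q ∈ A`. -/
structure HeadSplit (f : M →* P) (A : Set P) : Prop where
  map_zero : f 0 = 0
  exists_eq : ∀ p, p ≠ 0 → ∃ m q, m ≠ 0 ∧ q ∈ A ∧ p = f m * q
  ne_zero : ∀ m q, m ≠ 0 → q ∈ A → f m * q ≠ 0
  inj : ∀ m q m' q', m ≠ 0 → m' ≠ 0 → q ∈ A → q' ∈ A → f m * q = f m' * q' → m = m' ∧ q = q'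

/-- If `p ∈ A` is not right invertible, all its nonzero right multiples stay in `A`. -/
def AbsorbsMul (A : Set P) (p : P) : Prop :=
  p ∈ A → (¬ ∃ u, p * u = 1) → ∀ u, p * u = 0 ∨ p * u ∈ A

/-- The intersection of two principal right ideals is principal. -/
def HasLCM {M : Type*} [Mul M] (s t : M) : Prop :=
  ∃ r, ∀ x, ((∃ u, x = s * u) ∧ (∃ u, x = t * u)) ↔ ∃ u, x = r * u

theorem hasLCM_iff {M : Type*} [Monoid M] (s t : M) : HasLCM s t ↔ ∃ r, IsLCM s t r := by
  constructor
  · rintro ⟨r, hr⟩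
    obtain ⟨⟨u, hu⟩, ⟨v, hv⟩⟩ := (hr r).2 ⟨1, (mul_one r).symm⟩
    exact ⟨r, Set.ext hr, Or.inr ⟨u, hu.symm⟩, Or.inr ⟨v, hv.symm⟩⟩
  · rintro ⟨r, hr, -⟩
    exact ⟨r, fun x => Set.ext_iff.1 hr x⟩

theorem HasLCM.symm {M : Type*} [Mul M] {s t : M} (h : HasLCM s t) : HasLCM t s :=
  h.imp fun _ hr x => and_comm.trans (hr x)

theorem HasLCM.of_subset {M : Type*} [Monoid M] {s t : M} (h : ∃ u, t = s * u) :
    HasLCM s t := by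
  obtain ⟨u, rfl⟩ := h
  refine ⟨s * u, fun x => ⟨And.right, ?_⟩⟩
  rintro ⟨v, rfl⟩
  exact ⟨⟨u * v, mul_assoc _ _ _⟩, v, rfl⟩

theorem HasLCM.of_disjoint {s t : P} (h : ∀ u v, s * u = t * v → s * u = 0) : HasLCM s t := by
  refine ⟨0, fun x => ⟨?_, ?_⟩⟩
  · rintro ⟨⟨u, rfl⟩, v, hv⟩
    exact ⟨0, by rw [h u v hv, zero_mul]⟩
  · rintro ⟨u, rfl⟩
    exact ⟨⟨0, by simp⟩, 0, by simp⟩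

theorem HasLCM.congr_left {M : Type*} [Monoid M] {s s' t : M} (h : HasLCM s t)
    (h₁ : ∃ u, s' = s * u) (h₂ : ∃ u, s = s' * u) : HasLCM s' t := by
  obtain ⟨u, hu⟩ := h₁
  obtain ⟨v, hv⟩ := h₂
  refine h.imp fun r hr x => ?_
  rw [← hr x]
  refine and_congr_left fun _ => ⟨?_, ?_⟩
  · rintro ⟨w, rfl⟩
    exact ⟨u * w, by rw [hu, mul_assoc]⟩
  · rintro ⟨w, rfl⟩
    exact ⟨v * w, by rw [← mul_assoc, ← hv]⟩

theorem HasLCM.congr_of_rightInv {M : Type*} [Monoid M] {a s q t : M} (h : HasLCM a t)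
    (hs : s = a * q) (hq : ∃ u, q * u = 1) : HasLCM s t := by
  obtain ⟨u, hu⟩ := hq
  exact h.congr_left ⟨q, hs⟩ ⟨u, by rw [hs, mul_assoc, hu, mul_one]⟩

namespace HeadSplit

variable {f : M →* P} {A : Set P}

theorem mul_left_cancel (hf : HeadSplit f A)
    (hM : ∀ s t r : M, s * t = s * r → s * t ≠ 0 → t = r)
    (m : M) (t r : P) (h : f m * t = f m * r) (h0 : f m * t ≠ 0) : t = r := by
  obtain ⟨a, p, ha, hp, rfl⟩ := hf.exists_eq t (by rintro rfl; simp at h0)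
  obtain ⟨b, q, hb, hq, rfl⟩ := hf.exists_eq r (by rintro rfl; simp [h] at h0)
  have h0' : f m * (f b * q) ≠ 0 := h ▸ h0
  simp only [← mul_assoc, ← map_mul] at h h0 h0'
  have ha' : m * a ≠ 0 := by
    intro h; simp [h, hf.map_zero] at h0
  have hb' : m * b ≠ 0 := by
    intro h; simp [h, hf.map_zero] at h0'
  obtain ⟨h₁, rfl⟩ := hf.inj _ _ _ _ ha' hb' hp hq h
  rw [hM m a b h₁ ha']

/-- The elements `f m * q` with `m ≠ 1` do not lie in `A`. -/
theorem notMem (hf : HeadSplit f A) [Nontrivial M] {m : M} {q : P} (h0 : m ≠ 0) (h1 : m ≠ 1)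
    (hq : q ∈ A) : f m * q ∉ A := fun h =>
  h1 (hf.inj m q 1 (f m * q) h0 one_ne_zero hq h (by simp)).1

theorem absorbs (hf : HeadSplit f A) {B : Set P}
    (hAB : ∀ m q, m ≠ 0 → m ≠ 1 → q ∈ A → f m * q ∈ B)
    {m : M} {q : P} (h0 : m ≠ 0) (h1 : m ≠ 1) (hq : q ∈ A) (ih : AbsorbsMul A q) :
    AbsorbsMul B (f m * q) := by
  intro _ hinv u
  by_cases hqi : ∃ u, q * u = 1
  · rcases eq_or_ne (q * u) 0 with hz | hz
    · left; rw [mul_assoc, hz, mul_zero]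
    obtain ⟨m', v, -, hv, hm'⟩ := hf.exists_eq _ hz
    rw [mul_assoc, hm', ← mul_assoc, ← map_mul]
    rcases eq_or_ne (m * m') 0 with hz' | hz'
    · left; rw [hz', hf.map_zero, zero_mul]
    refine Or.inr (hAB _ _ hz' (fun h => hinv ?_) hv)
    obtain ⟨w, hw⟩ := hqi
    exact ⟨w * f m', by rw [mul_assoc, ← mul_assoc q, hw, one_mul, ← map_mul, h, map_one]⟩
  · rw [mul_assoc]
    rcases ih hq hqi u with h | h
    · left; rw [h, mul_zero]
    · exact Or.inr (hAB _ _ h0 h1 h)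

/-- If `q` is not right invertible, the right ideals of `f a` and `f b * q` are nested when `a`
divides `b` and meet only in `0` otherwise. -/
theorem hasLCM_of_not_rightInv (hf : HeadSplit f A) {a b : M} {q : P} (hb : b ≠ 0) (hq : q ∈ A)
    (hqi : ¬ ∃ u, q * u = 1) (habs : AbsorbsMul A q) : HasLCM (f a) (f b * q) := by
  by_cases hab : ∃ c, b = a * c
  · obtain ⟨c, rfl⟩ := hab
    exact .of_subset ⟨f c * q, by rw [map_mul, mul_assoc]⟩
  refine .of_disjoint fun u v h => ?_
  by_contra hne
  rw [mul_assoc] at h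
  obtain ⟨c, w, -, hw, rfl⟩ := hf.exists_eq u (by rintro rfl; simp at hne)
  rcases habs hq hqi v with hv | hv
  · rw [h, hv, mul_zero] at hne
    exact hne rfl
  rw [← mul_assoc, ← map_mul] at h hne
  have hac : a * c ≠ 0 := fun h => by simp [h, hf.map_zero] at hne
  exact hab ⟨c, (hf.inj _ _ _ _ hac hb hw hv h).1.symm⟩

theorem hasLCM_map (hf : HeadSplit f A) {a b : M} (h : HasLCM a b) : HasLCM (f a) (f b) := by
  obtain ⟨r, hr⟩ := h
  refine ⟨f r, fun x => ⟨?_, ?_⟩⟩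
  · rintro ⟨⟨u, rfl⟩, v, h⟩
    rcases eq_or_ne (f a * u) 0 with hz | hz
    · exact ⟨0, by rw [hz, mul_zero]⟩
    obtain ⟨c, p, -, hp, rfl⟩ := hf.exists_eq u (by rintro rfl; simp at hz)
    obtain ⟨d, q, -, hq, rfl⟩ := hf.exists_eq v (by rintro rfl; simp [h] at hz)
    have hz' := h ▸ hz
    simp only [← mul_assoc, ← map_mul] at h hz hz' ⊢
    have hac : a * c ≠ 0 := fun h => by simp [h, hf.map_zero] at hz
    have hbd : b * d ≠ 0 := fun h => by simp [h, hf.map_zero] at hz'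
    obtain ⟨e, he⟩ := (hr (a * c)).1
      ⟨⟨c, rfl⟩, d, (hf.inj _ _ _ _ hac hbd hp hq h).1⟩
    exact ⟨f e * p, by rw [he, map_mul, mul_assoc]⟩
  · rintro ⟨u, rfl⟩
    obtain ⟨⟨c, hc⟩, d, hd⟩ := (hr r).2 ⟨1, (mul_one r).symm⟩
    exact ⟨⟨f c * u, by rw [← mul_assoc, ← map_mul, ← hc]⟩,
      f d * u, by rw [← mul_assoc, ← map_mul, ← hd]⟩

theorem hasLCM (hf : HeadSplit f A) (habs : ∀ p ∈ A, AbsorbsMul A p)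
    (hM : ∀ a b : M, HasLCM a b) {a : M} {s : P} (ha : a ≠ 0) (hs : s ∈ A)
    (ih : ∀ t, HasLCM s t) (t : P) : HasLCM (f a * s) t := by
  rcases eq_or_ne t 0 with rfl | ht
  · exact .of_subset ⟨0, by simp⟩
  obtain ⟨b, t, hb, htA, rfl⟩ := hf.exists_eq t ht
  by_cases hsi : ∃ u, s * u = 1
  · refine HasLCM.congr_of_rightInv ?_ rfl hsi
    by_cases hti : ∃ u, t * u = 1
    · exact (HasLCM.congr_of_rightInv (hf.hasLCM_map (hM a b)).symm rfl hti).symm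
    · exact hf.hasLCM_of_not_rightInv hb htA hti (habs t htA)
  by_cases hti : ∃ u, t * u = 1
  · exact (HasLCM.congr_of_rightInv
      (hf.hasLCM_of_not_rightInv ha hs hsi (habs s hs)) rfl hti).symm
  have key : ∀ u v, f a * s * u = f b * t * v → f a * s * u ≠ 0 → a = b ∧ s * u = t * v := by
    intro u v h hne
    have hne' := h ▸ hne
    rw [mul_assoc] at hne hne'
    rw [mul_assoc, mul_assoc] at h
    exact hf.inj _ _ _ _ ha hb
      ((habs s hs hs hsi u).resolve_left fun h => hne (by rw [h, mul_zero]))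
      ((habs t htA htA hti v).resolve_left fun h => hne' (by rw [h, mul_zero])) h
  rcases eq_or_ne a b with rfl | hab
  · obtain ⟨r, hr⟩ := ih t
    refine ⟨f a * r, fun x => ⟨?_, ?_⟩⟩
    · rintro ⟨⟨u, rfl⟩, v, h⟩
      rcases eq_or_ne (f a * s * u) 0 with hz | hz
      · exact ⟨0, by rw [hz, mul_zero]⟩
      obtain ⟨w, hw⟩ := (hr (s * u)).1 ⟨⟨u, rfl⟩, v, (key u v h hz).2⟩
      exact ⟨w, by rw [mul_assoc, hw, mul_assoc]⟩
    · rintro ⟨w, rfl⟩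
      obtain ⟨⟨u, hu⟩, v, hv⟩ := (hr (r * w)).2 ⟨w, rfl⟩
      exact ⟨⟨u, by rw [mul_assoc, hu, mul_assoc]⟩, v, by rw [mul_assoc, hv, mul_assoc]⟩
  · refine .of_disjoint fun u v h => ?_
    by_contra hne
    exact hab (key u v h hne).1

end HeadSplit

end Abstract

section Peel

/-- A way of splitting off a nonzero first letter in `M` from each element of `W`. -/
structure Peel (M W : Type*) [MonoidWithZero M] where
  /-- The first letter in `M`, or `1` if there is none. -/
  hd : W → M
  /-- What remains after removing the first letter in `M`. -/
  tl : W → W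
  /-- Prepend a letter. -/
  cn : M → W → W
  hd_ne : ∀ w, hd w ≠ 0
  hd_tl : ∀ w, hd (tl w) = 1
  tl_eq : ∀ w, hd w = 1 → tl w = w
  cn_hd_tl : ∀ w, cn (hd w) (tl w) = w
  hd_cn : ∀ m w, m ≠ 0 → hd w = 1 → hd (cn m w) = m
  tl_cn : ∀ m w, m ≠ 0 → hd w = 1 → tl (cn m w) = w

variable {M W : Type*} [MonoidWithZero M] (e : Peel M W)

open Classical in
/-- Multiplication by `m` on the first letter, with `none` playing the role of zero. -/
noncomputable def Peel.smul (m : M) (x : Option W) : Option W :=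
  x.bind fun w => if m * e.hd w = 0 then none else some (e.cn (m * e.hd w) (e.tl w))

theorem Peel.smul_some_of_eq {m : M} {w : W} (h : m * e.hd w = 0) :
    e.smul m (some w) = none := by simp [Peel.smul, h]

theorem Peel.smul_some_of_ne {m : M} {w : W} (h : m * e.hd w ≠ 0) :
    e.smul m (some w) = some (e.cn (m * e.hd w) (e.tl w)) := by simp [Peel.smul, h]

theorem Peel.smul_some_of_hd {m : M} {w : W} (hm : m ≠ 0) (hw : e.hd w = 1) :
    e.smul m (some w) = some (e.cn m w) := by
  rw [e.smul_some_of_ne (by rwa [hw, mul_one]), hw, mul_one, e.tl_eq w hw]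

/-- `Peel.smul` as a monoid homomorphism. -/
noncomputable def Peel.act : M →* Function.End (Option W) where
  toFun m := e.smul m
  map_one' := by
    funext x
    rcases x with _ | w
    · rfl
    · rw [e.smul_some_of_ne (by simpa using e.hd_ne w), one_mul, e.cn_hd_tl]
      rfl
  map_mul' m m' := by
    funext x
    change _ = e.smul m (e.smul m' x)
    rcases x with _ | w
    · rfl
    by_cases h : m' * e.hd w = 0
    · rw [e.smul_some_of_eq h, e.smul_some_of_eq (by rw [mul_assoc, h, mul_zero])]
      rfl
    rw [e.smul_some_of_ne h]
    have h₁ := e.hd_cn _ _ h (e.hd_tl w)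
    have h₂ := e.tl_cn _ _ h (e.hd_tl w)
    by_cases h' : m * (m' * e.hd w) = 0
    · rw [e.smul_some_of_eq (by rwa [mul_assoc]), e.smul_some_of_eq (by rwa [h₁])]
    · rw [e.smul_some_of_ne (by rwa [mul_assoc]), e.smul_some_of_ne (by rwa [h₁]), h₁, h₂,
        mul_assoc]

theorem Peel.act_apply (m : M) (x : Option W) : e.act m x = e.smul m x := rfl

theorem Peel.act_zero (x : Option W) : e.act 0 x = none := by
  rcases x with _ | w
  · rfl
  · exact e.smul_some_of_eq (zero_mul _)

end Peel

namespace ZeroFreeProd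

section Words

variable {M N : Type*} [MonoidWithZero M] [MonoidWithZero N]

/-- The first letter if it lies in `M`, and `1` otherwise. -/
def headL : List (M ⊕ N) → M
  | .inl m :: _ => m
  | _ => 1

/-- The first letter if it lies in `N`, and `1` otherwise. -/
def headR : List (M ⊕ N) → N
  | .inr n :: _ => n
  | _ => 1

/-- Alternating words whose letters are neither `0` nor `1`. -/
inductive IsReduced : List (M ⊕ N) → Prop
  | nil : IsReduced []
  | inl (m : M) (w : List (M ⊕ N)) : m ≠ 0 → m ≠ 1 → headL w = 1 → IsReduced w →
      IsReduced (.inl m :: w)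
  | inr (n : N) (w : List (M ⊕ N)) : n ≠ 0 → n ≠ 1 → headR w = 1 → IsReduced w →
      IsReduced (.inr n :: w)

variable (M N) in
/-- The type of reduced words. -/
abbrev Word := {w : List (M ⊕ N) // IsReduced w}

open Classical in
/-- Splitting off a first letter in `M` from a reduced word. -/
noncomputable def peelL [Nontrivial M] : Peel M (Word M N) where
  hd w := headL w.1
  tl
    | ⟨.inl _ :: w, h⟩ => ⟨w, by cases h; assumption⟩
    | w => w
  cn m w := if h : m ≠ 0 ∧ m ≠ 1 ∧ headL w.1 = 1 then
    ⟨.inl m :: w.1, .inl m w.1 h.1 h.2.1 h.2.2 w.2⟩ else w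
  hd_ne := by
    rintro ⟨_, _ | ⟨m, w, h0, h1, hw, h⟩ | ⟨n, w, h0, h1, hw, h⟩⟩ <;> simp_all [headL]
  hd_tl := by
    rintro ⟨_, _ | ⟨m, w, h0, h1, hw, h⟩ | ⟨n, w, h0, h1, hw, h⟩⟩ <;> first | rfl | exact hw
  tl_eq := by
    rintro ⟨_, _ | ⟨m, w, h0, h1, hw, h⟩ | ⟨n, w, h0, h1, hw, h⟩⟩ <;> simp_all [headL]
  cn_hd_tl := by
    rintro ⟨_, _ | ⟨m, w, h0, h1, hw, h⟩ | ⟨n, w, h0, h1, hw, h⟩⟩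
    · exact dif_neg fun h => h.2.1 rfl
    · exact dif_pos ⟨h0, h1, hw⟩
    · exact dif_neg fun h => h.2.1 rfl
  hd_cn := by
    intro m w h0 hw
    by_cases h1 : m = 1
    · simp [h1, hw]
    · rw [dif_pos ⟨h0, h1, hw⟩]; rfl
  tl_cn := by
    intro m w h0 hw
    by_cases h1 : m = 1
    · obtain ⟨_, _ | ⟨m, w, h0, h1, hw, h⟩ | ⟨n, w, h0, h1, hw, h⟩⟩ := w <;> simp_all [headL]
    · rw [dif_pos ⟨h0, h1, hw⟩]

open Classical in
/-- Splitting off a first letter in `N` from a reduced word. -/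
noncomputable def peelR [Nontrivial N] : Peel N (Word M N) where
  hd w := headR w.1
  tl
    | ⟨.inr _ :: w, h⟩ => ⟨w, by cases h; assumption⟩
    | w => w
  cn n w := if h : n ≠ 0 ∧ n ≠ 1 ∧ headR w.1 = 1 then
    ⟨.inr n :: w.1, .inr n w.1 h.1 h.2.1 h.2.2 w.2⟩ else w
  hd_ne := by
    rintro ⟨_, _ | ⟨m, w, h0, h1, hw, h⟩ | ⟨n, w, h0, h1, hw, h⟩⟩ <;> simp_all [headR]
  hd_tl := by
    rintro ⟨_, _ | ⟨m, w, h0, h1, hw, h⟩ | ⟨n, w, h0, h1, hw, h⟩⟩ <;> first | rfl | exact hw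
  tl_eq := by
    rintro ⟨_, _ | ⟨m, w, h0, h1, hw, h⟩ | ⟨n, w, h0, h1, hw, h⟩⟩ <;> simp_all [headR]
  cn_hd_tl := by
    rintro ⟨_, _ | ⟨m, w, h0, h1, hw, h⟩ | ⟨n, w, h0, h1, hw, h⟩⟩
    · exact dif_neg fun h => h.2.1 rfl
    · exact dif_neg fun h => h.2.1 rfl
    · exact dif_pos ⟨h0, h1, hw⟩
  hd_cn := by
    intro n w h0 hw
    by_cases h1 : n = 1
    · simp [h1, hw]
    · rw [dif_pos ⟨h0, h1, hw⟩]; rfl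
  tl_cn := by
    intro n w h0 hw
    by_cases h1 : n = 1
    · obtain ⟨_, _ | ⟨m, w, h0, h1, hw, h⟩ | ⟨n, w, h0, h1, hw, h⟩⟩ := w <;> simp_all [headR]
    · rw [dif_pos ⟨h0, h1, hw⟩]

theorem peelL_cn [Nontrivial M] {m : M} {w : List (M ⊕ N)} (h0 : m ≠ 0) (h1 : m ≠ 1)
    (hw : headL w = 1) (h : IsReduced w) :
    peelL.cn m ⟨w, h⟩ = ⟨.inl m :: w, .inl m w h0 h1 hw h⟩ :=
  dif_pos ⟨h0, h1, hw⟩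

theorem peelR_cn [Nontrivial N] {n : N} {w : List (M ⊕ N)} (h0 : n ≠ 0) (h1 : n ≠ 1)
    (hw : headR w = 1) (h : IsReduced w) :
    peelR.cn n ⟨w, h⟩ = ⟨.inr n :: w, .inr n w h0 h1 hw h⟩ :=
  dif_pos ⟨h0, h1, hw⟩

end Words

section Model

variable (M N : Type*) [MonoidWithZero M] [MonoidWithZero N]

/-- The quotient map from the free product. -/
def mk : Coprod M N →* ZeroFreeProd M N := (reesCon M N).mk'

theorem mk_surjective : Function.Surjective (mk M N) := Con.mk'_surjective

variable {M N} in
theorem mk_eq_zero {x : Coprod M N} (hx : InZeroIdeal M N x) : mk M N x = zero M N :=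
  (Con.eq _).2 (ConGen.Rel.of _ _ ⟨hx, 1, 1, by simp⟩)

/-- The `0`-free product as a monoid with zero. -/
local instance instMonoidWithZero : MonoidWithZero (ZeroFreeProd M N) :=
  { instMonoid M N with
    zero := zero M N
    zero_mul := fun p => by
      obtain ⟨x, rfl⟩ := mk_surjective M N p
      exact ((mk M N).map_mul (Coprod.inl 0) x).symm.trans
        (mk_eq_zero ⟨1, x, by simp⟩)
    mul_zero := fun p => by
      obtain ⟨x, rfl⟩ := mk_surjective M N p
      exact ((mk M N).map_mul x (Coprod.inl 0)).symm.trans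
        (mk_eq_zero ⟨x, 1, by simp⟩) }

/-- The canonical map from the first factor. -/
def inl : M →* ZeroFreeProd M N := (mk M N).comp Coprod.inl

/-- The canonical map from the second factor. -/
def inr : N →* ZeroFreeProd M N := (mk M N).comp Coprod.inr

theorem inl_zero : inl M N 0 = 0 := rfl

theorem inr_zero : inr M N 0 = 0 := mk_eq_zero ⟨1, 1, by simp⟩

variable {M N} in
theorem induction_gen {S : ZeroFreeProd M N → Prop} (one : S 1)
    (inl_mul : ∀ m p, S p → S (inl M N m * p)) (inr_mul : ∀ n p, S p → S (inr M N n * p))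
    (p : ZeroFreeProd M N) : S p := by
  obtain ⟨x, rfl⟩ := mk_surjective M N p
  induction x using Coprod.induction_on' with
  | one => simpa using one
  | inl_mul m x ih => rw [map_mul]; exact inl_mul m _ ih
  | inr_mul n x ih => rw [map_mul]; exact inr_mul n _ ih

variable {M N} in
/-- The product of the letters of a word. -/
def ofList (w : List (M ⊕ N)) : ZeroFreeProd M N := (w.map (Sum.elim (inl M N) (inr M N))).prod

variable {M N} in
/-- The product of the letters of a reduced word, extended by zero. -/
def ofOption (x : Option (Word M N)) : ZeroFreeProd M N := x.elim 0 fun w => ofList w.1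

variable {M N} in
theorem ofList_peelL_cn [Nontrivial M] {m : M} (w : Word M N) (h0 : m ≠ 0) (hw : peelL.hd w = 1) :
    ofList (peelL.cn m w).1 = inl M N m * ofList w.1 := by
  by_cases h1 : m = 1
  · simp [h1, peelL]
  · rw [peelL_cn h0 h1 hw w.2]
    simp [ofList]

variable {M N} in
theorem ofList_peelR_cn [Nontrivial N] {n : N} (w : Word M N) (h0 : n ≠ 0) (hw : peelR.hd w = 1) :
    ofList (peelR.cn n w).1 = inr M N n * ofList w.1 := by
  by_cases h1 : n = 1
  · simp [h1, peelR]
  · rw [peelR_cn h0 h1 hw w.2]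
    simp [ofList]

variable {M N} in
/-- If prepending a letter to a word multiplies its value by the letter, then the action of
a letter is compatible with multiplication. -/
theorem ofOption_smul {K : Type*} [MonoidWithZero K] (e : Peel K (Word M N))
    (f : K →* ZeroFreeProd M N) (hf : f 0 = 0)
    (hcn : ∀ (k : K) (w : Word M N), k ≠ 0 → e.hd w = 1 →
      ofList (e.cn k w).1 = f k * ofList w.1)
    (k : K) (x : Option (Word M N)) : ofOption (e.smul k x) = f k * ofOption x := by
  rcases x with _ | w
  · exact (mul_zero _).symm
  have hw : ofList w.1 = f (e.hd w) * ofList (e.tl w).1 := by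
    rw [← hcn _ _ (e.hd_ne w) (e.hd_tl w), e.cn_hd_tl]
  change _ = f k * ofList w.1
  rw [hw, ← mul_assoc, ← map_mul]
  by_cases h : k * e.hd w = 0
  · rw [e.smul_some_of_eq h, h, hf, zero_mul]
    rfl
  · rw [e.smul_some_of_ne h, ← hcn _ _ h (e.hd_tl w)]
    rfl

variable [Nontrivial M] [Nontrivial N]

/-- The action of the free product on reduced words with a zero adjoined. -/
noncomputable def coprodAct : Coprod M N →* Function.End (Option (Word M N)) :=
  Coprod.lift peelL.act peelR.act

theorem coprodAct_none (x : Coprod M N) : coprodAct M N x none = none := by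
  induction x using Coprod.induction_on' with
  | one => simp; rfl
  | inl_mul m x ih =>
    rw [map_mul]
    change coprodAct M N (Coprod.inl m) (coprodAct M N x none) = none
    rw [ih]
    simp [coprodAct, Peel.act_apply, Peel.smul]
  | inr_mul m x ih =>
    rw [map_mul]
    change coprodAct M N (Coprod.inr m) (coprodAct M N x none) = none
    rw [ih]
    simp [coprodAct, Peel.act_apply, Peel.smul]

variable {M N} in
theorem coprodAct_of_inZeroIdeal {x : Coprod M N} (hx : InZeroIdeal M N x)
    (w : Option (Word M N)) : coprodAct M N x w = none := by
  obtain ⟨a, b, rfl | rfl⟩ := hx <;> rw [map_mul, map_mul]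
  · change coprodAct M N a (coprodAct M N (Coprod.inl 0) (coprodAct M N b w)) = none
    rw [coprodAct, Coprod.lift_apply_inl, Peel.act_zero]
    exact coprodAct_none M N a
  · change coprodAct M N a (coprodAct M N (Coprod.inr 0) (coprodAct M N b w)) = none
    rw [coprodAct, Coprod.lift_apply_inr, Peel.act_zero]
    exact coprodAct_none M N a

/-- The action of the `0`-free product on reduced words with a zero adjoined. -/
noncomputable def act : ZeroFreeProd M N →* Function.End (Option (Word M N)) :=
  (reesCon M N).lift (coprodAct M N) <| Con.conGen_le.2 fun x y h => by
    rw [Con.ker_rel]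
    funext w
    rw [coprodAct_of_inZeroIdeal h.1, coprodAct_of_inZeroIdeal h.2]

variable {M N}

theorem act_inl (m : M) : act M N (inl M N m) = peelL.act m :=
  Coprod.lift_apply_inl peelL.act peelR.act m

theorem act_inr (n : N) : act M N (inr M N n) = peelR.act n :=
  Coprod.lift_apply_inr peelL.act peelR.act n

theorem ofOption_act (p : ZeroFreeProd M N) (x : Option (Word M N)) :
    ofOption (act M N p x) = p * ofOption x := by
  induction p using induction_gen with
  | one => rw [map_one, one_mul]; rfl
  | inl_mul m p ih =>
    rw [map_mul, act_inl, mul_assoc, ← ih]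
    exact ofOption_smul peelL (inl M N) (inl_zero M N) (fun _ => ofList_peelL_cn) m _
  | inr_mul n p ih =>
    rw [map_mul, act_inr, mul_assoc, ← ih]
    exact ofOption_smul peelR (inr M N) (inr_zero M N) (fun _ => ofList_peelR_cn) n _

/-- The reduced word representing an element, with `none` representing zero. -/
noncomputable def toOption (p : ZeroFreeProd M N) : Option (Word M N) :=
  act M N p (some ⟨[], .nil⟩)

theorem ofOption_toOption (p : ZeroFreeProd M N) : ofOption (toOption p) = p :=
  (ofOption_act p _).trans (mul_one p)

theorem toOption_zero : toOption (0 : ZeroFreeProd M N) = none := by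
  rw [toOption, ← inl_zero, act_inl, Peel.act_zero]

theorem toOption_ofList (w : Word M N) : toOption (ofList w.1) = some w := by
  obtain ⟨w, hw⟩ := w
  induction hw with
  | nil => simp [ofList, toOption]; rfl
  | inl m w h0 h1 hd hw ih =>
    have : ofList (.inl m :: w) = inl M N m * ofList w := by simp [ofList]
    rw [this, toOption, map_mul, act_inl]
    change peelL.smul m (toOption (ofList w)) = _
    rw [ih, peelL.smul_some_of_hd (w := ⟨w, hw⟩) h0 hd, peelL_cn h0 h1 hd hw]
  | inr n w h0 h1 hd hw ih =>
    have : ofList (.inr n :: w) = inr M N n * ofList w := by simp [ofList]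
    rw [this, toOption, map_mul, act_inr]
    change peelR.smul n (toOption (ofList w)) = _
    rw [ih, peelR.smul_some_of_hd (w := ⟨w, hw⟩) h0 hd, peelR_cn h0 h1 hd hw]

theorem exists_word {p : ZeroFreeProd M N} (hp : p ≠ 0) : ∃ w : Word M N, ofList w.1 = p := by
  rcases h : toOption p with _ | w
  · refine absurd ?_ hp
    rw [← ofOption_toOption p, h]
    rfl
  · refine ⟨w, ?_⟩
    rw [← ofOption_toOption p, h]
    rfl

theorem ofList_ne_zero (w : Word M N) : ofList w.1 ≠ 0 := fun h => by
  have := toOption_ofList w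
  rw [h, toOption_zero] at this
  cases this

theorem ofList_injective {w w' : Word M N} (h : ofList w.1 = ofList w'.1) : w = w' := by
  rw [← Option.some_inj, ← toOption_ofList, ← toOption_ofList, h]

theorem headSplit_of_peel {K : Type*} [MonoidWithZero K] (e : Peel K (Word M N))
    (f : K →* ZeroFreeProd M N) (hf : f 0 = 0)
    (hcn : ∀ (k : K) (w : Word M N), k ≠ 0 → e.hd w = 1 →
      ofList (e.cn k w).1 = f k * ofList w.1) :
    HeadSplit f {p | ∃ w, e.hd w = 1 ∧ ofList w.1 = p} where
  map_zero := hf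
  exists_eq p hp := by
    obtain ⟨w, rfl⟩ := exists_word hp
    refine ⟨e.hd w, _, e.hd_ne w, ⟨e.tl w, e.hd_tl w, rfl⟩, ?_⟩
    rw [← hcn _ _ (e.hd_ne w) (e.hd_tl w), e.cn_hd_tl]
  ne_zero := by
    rintro k _ hk ⟨w, hw, rfl⟩
    rw [← hcn _ _ hk hw]
    exact ofList_ne_zero _
  inj := by
    rintro k _ k' _ hk hk' ⟨w, hw, rfl⟩ ⟨w', hw', rfl⟩ h
    rw [← hcn _ _ hk hw, ← hcn _ _ hk' hw'] at h
    have h := ofList_injective h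
    have h₁ := congrArg e.hd h
    have h₂ := congrArg e.tl h
    rw [e.hd_cn _ _ hk hw, e.hd_cn _ _ hk' hw'] at h₁
    rw [e.tl_cn _ _ hk hw, e.tl_cn _ _ hk' hw'] at h₂
    exact ⟨h₁, by rw [h₂]⟩

variable (M N) in
/-- The nonzero elements whose reduced word does not start with a letter in `M`. -/
def notStartL : Set (ZeroFreeProd M N) := {p | ∃ w, peelL.hd w = 1 ∧ ofList w.1 = p}

variable (M N) in
/-- The nonzero elements whose reduced word does not start with a letter in `N`. -/
def notStartR : Set (ZeroFreeProd M N) := {p | ∃ w, peelR.hd w = 1 ∧ ofList w.1 = p}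

variable (M N) in
theorem headSplit_inl : HeadSplit (inl M N) (notStartL M N) :=
  headSplit_of_peel peelL _ (inl_zero M N) fun _ => ofList_peelL_cn

variable (M N) in
theorem headSplit_inr : HeadSplit (inr M N) (notStartR M N) :=
  headSplit_of_peel peelR _ (inr_zero M N) fun _ => ofList_peelR_cn

theorem inl_mul_mem (m : M) (q : ZeroFreeProd M N) (h0 : m ≠ 0) (h1 : m ≠ 1)
    (hq : q ∈ notStartL M N) : inl M N m * q ∈ notStartR M N := by
  obtain ⟨w, hw, rfl⟩ := hq
  exact ⟨⟨_, .inl m w.1 h0 h1 hw w.2⟩, rfl, by simp [ofList]⟩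

theorem inr_mul_mem (n : N) (q : ZeroFreeProd M N) (h0 : n ≠ 0) (h1 : n ≠ 1)
    (hq : q ∈ notStartR M N) : inr M N n * q ∈ notStartL M N := by
  obtain ⟨w, hw, rfl⟩ := hq
  exact ⟨⟨_, .inr n w.1 h0 h1 hw w.2⟩, rfl, by simp [ofList]⟩

theorem induction_reduced {S : ZeroFreeProd M N → Prop} (one : S 1)
    (inl_mul : ∀ m q, m ≠ 0 → m ≠ 1 → q ∈ notStartL M N → S q → S (inl M N m * q))
    (inr_mul : ∀ n q, n ≠ 0 → n ≠ 1 → q ∈ notStartR M N → S q → S (inr M N n * q))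
    (p : ZeroFreeProd M N) (hp : p ≠ 0) : S p := by
  obtain ⟨⟨w, hw⟩, rfl⟩ := exists_word hp
  clear hp
  induction hw with
  | nil => exact one
  | inl m w h0 h1 hd hw ih =>
    simpa [ofList] using inl_mul m _ h0 h1 ⟨⟨w, hw⟩, hd, rfl⟩ ih
  | inr n w h0 h1 hd hw ih =>
    simpa [ofList] using inr_mul n _ h0 h1 ⟨⟨w, hw⟩, hd, rfl⟩ ih

theorem absorbs (p : ZeroFreeProd M N) (hp : p ≠ 0) :
    AbsorbsMul (notStartL M N) p ∧ AbsorbsMul (notStartR M N) p := by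
  refine induction_reduced
    (S := fun p => AbsorbsMul (notStartL M N) p ∧ AbsorbsMul (notStartR M N) p)
    ?_ (fun m q h0 h1 hq ih => ?_) (fun n q h0 h1 hq ih => ?_) p hp
  · exact ⟨fun _ h => absurd ⟨1, one_mul 1⟩ h, fun _ h => absurd ⟨1, one_mul 1⟩ h⟩
  · exact ⟨fun h => absurd h ((headSplit_inl M N).notMem h0 h1 hq),
      (headSplit_inl M N).absorbs inl_mul_mem h0 h1 hq ih.1⟩
  · exact ⟨(headSplit_inr M N).absorbs inr_mul_mem h0 h1 hq ih.2,
      fun h => absurd h ((headSplit_inr M N).notMem h0 h1 hq)⟩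

theorem absorbs_notStartL (p : ZeroFreeProd M N) (hp : p ∈ notStartL M N) :
    AbsorbsMul (notStartL M N) p := by
  refine (absorbs p ?_).1
  obtain ⟨w, -, rfl⟩ := hp
  exact ofList_ne_zero w

theorem absorbs_notStartR (p : ZeroFreeProd M N) (hp : p ∈ notStartR M N) :
    AbsorbsMul (notStartR M N) p := by
  refine (absorbs p ?_).2
  obtain ⟨w, -, rfl⟩ := hp
  exact ofList_ne_zero w

theorem mul_left_cancel_of_ne_zero
    (hM : ∀ s t r : M, s * t = s * r → s * t ≠ 0 → t = r)
    (hN : ∀ s t r : N, s * t = s * r → s * t ≠ 0 → t = r)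
    (s t r : ZeroFreeProd M N) (h : s * t = s * r) (h0 : s * t ≠ 0) : t = r := by
  induction s using induction_gen with
  | one => simpa using h
  | inl_mul m p ih =>
    rw [mul_assoc] at h h0
    rw [mul_assoc] at h
    exact ih ((headSplit_inl M N).mul_left_cancel hM m _ _ h h0) (right_ne_zero_of_mul h0)
  | inr_mul n p ih =>
    rw [mul_assoc] at h h0
    rw [mul_assoc] at h
    exact ih ((headSplit_inr M N).mul_left_cancel hN n _ _ h h0) (right_ne_zero_of_mul h0)

theorem hasLCM (hM : ∀ a b : M, HasLCM a b) (hN : ∀ a b : N, HasLCM a b)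
    (s t : ZeroFreeProd M N) : HasLCM s t := by
  rcases eq_or_ne s 0 with rfl | hs
  · exact (HasLCM.of_subset ⟨0, by simp⟩).symm
  refine induction_reduced (S := fun s => ∀ t, HasLCM s t) (fun t => .of_subset ⟨t, by simp⟩)
    (fun m q h0 _ hq ih => ?_) (fun n q h0 _ hq ih => ?_) s hs t
  · exact (headSplit_inl M N).hasLCM absorbs_notStartL hM h0 hq ih
  · exact (headSplit_inr M N).hasLCM absorbs_notStartR hN h0 hq ih

end Model

end ZeroFreeProd

/-- The `0`-free product of non-trivial `0`-left cancellative lcm monoids with zero is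
again a `0`-left cancellative monoid with zero admitting least common multiples. -/
theorem zeroFreeProd.lcm (M N : Type*) [MonoidWithZero M] [MonoidWithZero N]
    (hM : ∃ m : M, m ≠ 0 ∧ m ≠ 1) (hN : ∃ n : N, n ≠ 0 ∧ n ≠ 1)
    (hMlc : ∀ s t r : M, s * t = s * r → s * t ≠ 0 → t = r)
    (hNlc : ∀ s t r : N, s * t = s * r → s * t ≠ 0 → t = r)
    (hMlcm : ∀ s t : M, ∃ r : M, IsLCM s t r)
    (hNlcm : ∀ s t : N, ∃ r : N, IsLCM s t r) :
    (∀ s t r : ZeroFreeProd M N,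
        s * t = s * r → s * t ≠ ZeroFreeProd.zero M N → t = r) ∧
    (∀ s t : ZeroFreeProd M N, ∃ r : ZeroFreeProd M N, IsLCM s t r) := by
  obtain ⟨m, hm, -⟩ := hM
  obtain ⟨n, hn, -⟩ := hN
  have : Nontrivial M := ⟨m, 0, hm⟩
  have : Nontrivial N := ⟨n, 0, hn⟩
  refine ⟨ZeroFreeProd.mul_left_cancel_of_ne_zero hMlc hNlc, fun s t => ?_⟩
  exact (hasLCM_iff s t).1 (ZeroFreeProd.hasLCM
    (fun a b => (hasLCM_iff a b).2 (hMlcm a b)) (fun a b => (hasLCM_iff a b).2 (hNlcm a b)) s t)
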